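/- Let ψ be an admissible obstacle, γ₀ ∈ P_ψ, and let γ ∈ M_{γ₀} minimize the length L over M_{γ₀}, with graph reparametrization u. Then ∫₀¹ (u'/√(1+u'²))·φ' dx ≥ 0 for every nonnegative φ ∈ C₀^∞(0,1). Moreover, the set U := {x ∈ (0,1) : (x,u(x)) ∉ γ₀([0,1])} is open, u ∈ C^∞(U), and u'' = 0 on U. -/

import Mathlib

open MeasureTheory Set Topology Filter

noncomputable section

/-- A function of class `W^{2,2}(0,1)`, identified with its `C¹([0,1])` representative:
`u` has weak derivatives `du`, `ddu` (encoded through the fundamental theorem of calculus)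
with `du, ddu ∈ L¹(0,1)` and `ddu ∈ L²(0,1)`. -/
structure W22 where
  u : ℝ → ℝ
  du : ℝ → ℝ
  ddu : ℝ → ℝ
  du_int : IntegrableOn du (Icc (0:ℝ) 1)
  ddu_int : IntegrableOn ddu (Icc (0:ℝ) 1)
  ddu_sq : IntegrableOn (fun x => (ddu x)^2) (Icc (0:ℝ) 1)
  ftc_u : ∀ x ∈ Icc (0:ℝ) 1, u x = u 0 + ∫ s in (0:ℝ)..x, du s
  ftc_du : ∀ x ∈ Icc (0:ℝ) 1, du x = du 0 + ∫ s in (0:ℝ)..x, ddu s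

/-- The elastic energy of a graph. -/
def graphE (f : W22) : ℝ :=
  ∫ x in Ioo (0:ℝ) 1, (f.ddu x)^2 / (1 + (f.du x)^2) ^ ((5:ℝ)/2)

/-- The length of a graph. -/
def graphLen (f : W22) : ℝ :=
  ∫ x in Ioo (0:ℝ) 1, Real.sqrt (1 + (f.du x)^2)

/-- The length-penalized elastic energy of a graph. -/
def graphPE (ε : ℝ) (f : W22) : ℝ := graphE f + ε * graphLen f

/-- Membership in the admissible class `G_ψ`. -/
def MemG (ψ : ℝ → ℝ) (f : W22) : Prop :=
  f.u 0 = 0 ∧ f.u 1 = 0 ∧ ∀ x ∈ Icc (0:ℝ) 1, ψ x ≤ f.u x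

/-- An admissible obstacle. -/
structure Admissible (ψ : ℝ → ℝ) : Prop where
  cont : ContinuousOn ψ (Icc 0 1)
  neg0 : ψ 0 < 0
  neg1 : ψ 1 < 0
  pos : ∃ x ∈ Icc (0:ℝ) 1, 0 < ψ x
  osd : ∃ C : ℝ, ∀ x ∈ Ioo (0:ℝ) 1,
      (∃ d : ℝ, |d| ≤ C ∧ HasDerivWithinAt ψ d (Ici x) x) ∧
      (∃ d : ℝ, |d| ≤ C ∧ HasDerivWithinAt ψ d (Iic x) x)

/-- `‖ψ'‖_∞`, the smallest uniform bound for the one-sided derivatives of `ψ` on `(0,1)`. -/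
def obstNorm (ψ : ℝ → ℝ) : ℝ :=
  sInf {C : ℝ | 0 ≤ C ∧ ∀ x ∈ Ioo (0:ℝ) 1, ∀ d : ℝ,
    (HasDerivWithinAt ψ d (Ici x) x ∨ HasDerivWithinAt ψ d (Iic x) x) → |d| ≤ C}

/-- A planar curve on `(0,1)` of class `W^{1,1}((0,1);ℝ²)`. -/
structure Curve1 where
  x : ℝ → ℝ
  y : ℝ → ℝ
  dx : ℝ → ℝ
  dy : ℝ → ℝ
  dx_int : IntegrableOn dx (Icc (0:ℝ) 1)
  dy_int : IntegrableOn dy (Icc (0:ℝ) 1)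
  ftc_x : ∀ t ∈ Icc (0:ℝ) 1, x t = x 0 + ∫ s in (0:ℝ)..t, dx s
  ftc_y : ∀ t ∈ Icc (0:ℝ) 1, y t = y 0 + ∫ s in (0:ℝ)..t, dy s

/-- A planar curve of class `W^{1,1}((0,1);ℝ²) ∩ W^{2,1}_loc((0,1);ℝ²)`. -/
structure Curve extends Curve1 where
  ddx : ℝ → ℝ
  ddy : ℝ → ℝ
  ddx_loc : ∀ a b : ℝ, 0 < a → b < 1 → IntegrableOn ddx (Icc a b)
  ddy_loc : ∀ a b : ℝ, 0 < a → b < 1 → IntegrableOn ddy (Icc a b)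
  ftc_dx : ∀ a ∈ Ioo (0:ℝ) 1, ∀ t ∈ Ioo (0:ℝ) 1, dx t = dx a + ∫ s in a..t, ddx s
  ftc_dy : ∀ a ∈ Ioo (0:ℝ) 1, ∀ t ∈ Ioo (0:ℝ) 1, dy t = dy a + ∫ s in a..t, ddy s

/-- `|γ'(t)|`. -/
def speed1 (γ : Curve1) (t : ℝ) : ℝ := Real.sqrt ((γ.dx t)^2 + (γ.dy t)^2)

/-- The length `L(γ) = ∫₀¹ |γ'| dt`, as an extended real number. -/
def len1E (γ : Curve1) : ENNReal := ∫⁻ t in Ioo (0:ℝ) 1, ENNReal.ofReal (speed1 γ t)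

/-- The length `L(γ)`, as a real number. -/
def len1 (γ : Curve1) : ℝ := ∫ t in Ioo (0:ℝ) 1, speed1 γ t

def lenE (γ : Curve) : ENNReal := len1E γ.toCurve1

/-- The integrand `⟨γ'', N_γ⟩²/|γ'|³` of the elastic energy. -/
def elInt (γ : Curve) (t : ℝ) : ℝ :=
  (γ.dx t * γ.ddy t - γ.dy t * γ.ddx t)^2 / ((γ.dx t)^2 + (γ.dy t)^2) ^ ((5:ℝ)/2)

/-- Elastic energy of a curve, as an extended real number. -/
def elE (γ : Curve) : ENNReal := ∫⁻ t in Ioo (0:ℝ) 1, ENNReal.ofReal (elInt γ t)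

/-- The length-penalized elastic energy `E_ε = E + ε·L`. -/
def penE (ε : ℝ) (γ : Curve) : ENNReal := elE γ + ENNReal.ofReal ε * lenE γ

/-- A curve is immersed if `|γ'| > ε` on `(0,1)` for some `ε > 0`. -/
def Curve.Immersed (γ : Curve) : Prop :=
  ∃ ε > 0, ∀ t ∈ Ioo (0:ℝ) 1, ε < speed1 γ.toCurve1 t

/-- `u` lies in `W^{2,2}_loc(c,d)` with weak derivatives `du`, `ddu`. -/
structure W22locOn (u du ddu : ℝ → ℝ) (c d : ℝ) : Prop where
  du_loc : ∀ a b : ℝ, c < a → b < d → IntegrableOn du (Icc a b)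
  ddu_loc : ∀ a b : ℝ, c < a → b < d → IntegrableOn ddu (Icc a b)
  ddu_sq : ∀ a b : ℝ, c < a → b < d → IntegrableOn (fun t => (ddu t)^2) (Icc a b)
  ftc_u : ∀ a ∈ Ioo c d, ∀ t ∈ Ioo c d, u t = u a + ∫ s in a..t, du s
  ftc_du : ∀ a ∈ Ioo c d, ∀ t ∈ Ioo c d, du t = du a + ∫ s in a..t, ddu s

/-- `γ` is a pseudograph. -/
def Pseudograph (γ : Curve) : Prop :=
  γ.Immersed ∧ (∀ t ∈ Ioo (0:ℝ) 1, 0 ≤ γ.dx t) ∧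
  ∀ a b : ℝ, 0 ≤ a → a < b → b ≤ 1 → (∀ t ∈ Ioo a b, 0 < γ.dx t) →
    ∃ u du ddu : ℝ → ℝ, W22locOn u du ddu (γ.x a) (γ.x b) ∧
      ∀ t ∈ Ioo a b, u (γ.x t) = γ.y t

/-- Membership in `P_ψ`. -/
def MemP (ψ : ℝ → ℝ) (γ : Curve) : Prop :=
  Pseudograph γ ∧ γ.x 0 = 0 ∧ γ.y 0 = 0 ∧ γ.x 1 = 1 ∧ γ.y 1 = 0 ∧
  ∀ t ∈ Icc (0:ℝ) 1, ψ (γ.x t) ≤ γ.y t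

/-- `v : (a,b) → (c,d)` is invertible in `W^{1,1}` (increasing case): it has an
inverse `w` which is again of class `W^{1,1}`. -/
def InvertibleW11On (v : ℝ → ℝ) (a b c d : ℝ) : Prop :=
  ∃ w dw : ℝ → ℝ, IntegrableOn dw (Icc c d) ∧
    (∀ s ∈ Icc c d, w s = w c + ∫ r in c..s, dw r) ∧
    (∀ t ∈ Ioo a b, v t ∈ Ioo c d ∧ w (v t) = t) ∧
    (∀ s ∈ Ioo c d, w s ∈ Ioo a b ∧ v (w s) = s)

/-- `γ ∈ M_{γ₀}`: a `∩`-shaped curve above `γ₀` with parameters `β₁, β₂` and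
graph reparametrization `u`. -/
structure CapAbove (γ : Curve1) (γ₀ : Curve) (β₁ β₂ : ℝ) (u : ℝ → ℝ) : Prop where
  ep0 : γ.x 0 = 0 ∧ γ.y 0 = 0
  ep1 : γ.x 1 = 1 ∧ γ.y 1 = 0
  hβ : 0 ≤ β₁ ∧ β₁ < β₂ ∧ β₂ ≤ 1
  left : ∀ t ∈ Icc (0:ℝ) β₁, γ.x t = 0
  right : ∀ t ∈ Icc β₂ (1:ℝ), γ.x t = 1
  inv : InvertibleW11On γ.x β₁ β₂ 0 1
  graph : ∀ t ∈ Ioo β₁ β₂, u (γ.x t) = γ.y t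
  ucont : ContinuousOn u (Icc (0:ℝ) 1)
  above : ∀ t ∈ Icc (0:ℝ) 1, γ₀.y t ≤ u (γ₀.x t)

/-- A `∩`-shaped pseudograph with parameters `β₁, β₂` and graph reparametrization `u`
(with weak derivatives `du`, `ddu`). -/
structure CapShaped (γ : Curve) (β₁ β₂ : ℝ) (u du ddu : ℝ → ℝ) : Prop where
  hβ : 0 ≤ β₁ ∧ β₁ < β₂ ∧ β₂ ≤ 1
  left : ∀ t ∈ Icc (0:ℝ) β₁, γ.x t = 0
  right : ∀ t ∈ Icc β₂ (1:ℝ), γ.x t = 1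
  pos : ∀ t ∈ Ioo β₁ β₂, 0 < γ.dx t
  graph : ∀ t ∈ Ioo β₁ β₂, u (γ.x t) = γ.y t
  reg : W22locOn u du ddu 0 1

/-- `G(x) = ∫₀ˣ (1+s²)^{-5/4} ds`. -/
def Gfun (x : ℝ) : ℝ := ∫ s in (0:ℝ)..x, ((1 + s^2) ^ (-(5:ℝ)/4) : ℝ)

/-- `c₀ = ∫_ℝ (1+s²)^{-5/4} ds`. -/
def c0 : ℝ := ∫ s : ℝ, ((1 + s^2) ^ (-(5:ℝ)/4) : ℝ)

/-- The inverse of `G`. -/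
def Ginv : ℝ → ℝ := Function.invFun Gfun

/-- The ratio `R(B)` from the nonexistence theorem. -/
def ratio (B : ℝ) : ℝ :=
  (∫ t in (0:ℝ)..B, t / (Real.sqrt (B - t) * (1 + t^2) ^ ((5:ℝ)/4))) /
  (2 * ∫ t in (0:ℝ)..B, 1 / (Real.sqrt (B - t) * (1 + t^2) ^ ((5:ℝ)/4)))

/-- The symmetric cone obstacle with valley `[0,s]` and peak `A`. -/
def coneObstacle (A s : ℝ) : ℝ → ℝ := fun x =>
  if x ≤ 1/2 then A / (1/2 - s) * (x - s) else A / (1/2 - s) * (1 - s - x)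

lemma MeasureTheory.IntegrableOn.intervalIntegrable_of_mem {f : ℝ → ℝ} {a b p q : ℝ}
    (hf : IntegrableOn f (Icc a b)) (hp : p ∈ Icc a b) (hq : q ∈ Icc a b) :
    IntervalIntegrable f volume p q :=
  (hf.mono_set (uIcc_subset_Icc hp hq)).intervalIntegrable

lemma sub_eq_integral_of_primitive {f f' : ℝ → ℝ} (hf' : IntegrableOn f' (Icc (0 : ℝ) 1))
    (hf : ∀ t ∈ Icc (0 : ℝ) 1, f t = f 0 + ∫ s in (0 : ℝ)..t, f' s) {p q : ℝ}
    (hp : p ∈ Icc (0 : ℝ) 1) (hq : q ∈ Icc (0 : ℝ) 1) :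
    f q - f p = ∫ s in p..q, f' s := by
  have h0 : (0 : ℝ) ∈ Icc (0 : ℝ) 1 := by simp
  rw [hf q hq, hf p hp, ← intervalIntegral.integral_interval_sub_left
    (hf'.intervalIntegrable_of_mem h0 hq) (hf'.intervalIntegrable_of_mem h0 hp)]
  ring

lemma continuousOn_of_primitive {f f' : ℝ → ℝ} (hf' : IntegrableOn f' (Icc (0 : ℝ) 1))
    (hf : ∀ t ∈ Icc (0 : ℝ) 1, f t = f 0 + ∫ s in (0 : ℝ)..t, f' s) :
    ContinuousOn f (Icc (0 : ℝ) 1) := by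
  have h := intervalIntegral.continuousOn_primitive_interval (μ := volume) (f := f') (a := 0)
    (b := 1) (by rwa [uIcc_of_le zero_le_one])
  rw [uIcc_of_le zero_le_one] at h
  exact (continuousOn_const.add h).congr hf

lemma Curve1.continuousOn_x (γ : Curve1) : ContinuousOn γ.x (Icc (0 : ℝ) 1) :=
  continuousOn_of_primitive γ.dx_int γ.ftc_x

lemma Curve1.continuousOn_y (γ : Curve1) : ContinuousOn γ.y (Icc (0 : ℝ) 1) :=
  continuousOn_of_primitive γ.dy_int γ.ftc_y

lemma sqrt_sq_add_sq_le (a b : ℝ) : √(a ^ 2 + b ^ 2) ≤ |a| + |b| := by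
  rw [Real.sqrt_le_left (by positivity)]
  nlinarith [sq_abs a, sq_abs b, mul_nonneg (abs_nonneg a) (abs_nonneg b)]

lemma integrableOn_sqrt_sq_add_sq {f g : ℝ → ℝ} {s : Set ℝ} (hf : IntegrableOn f s)
    (hg : IntegrableOn g s) : IntegrableOn (fun x => √((f x) ^ 2 + (g x) ^ 2)) s := by
  refine (hf.abs.add hg.abs).mono' ?_ (Eventually.of_forall fun x => ?_)
  · exact Real.continuous_sqrt.comp_aestronglyMeasurable
      ((hf.aestronglyMeasurable.pow 2).add (hg.aestronglyMeasurable.pow 2))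
  · rw [Real.norm_of_nonneg (Real.sqrt_nonneg _)]
    exact sqrt_sq_add_sq_le _ _

lemma integrableOn_sqrt_one_add_sq {f : ℝ → ℝ} {a b : ℝ} (hf : IntegrableOn f (Icc a b)) :
    IntegrableOn (fun x => √(1 + (f x) ^ 2)) (Icc a b) := by
  have h1 : IntegrableOn (fun _ : ℝ => (1 : ℝ)) (Icc a b) :=
    (continuous_const.integrableOn_Icc)
  simpa using integrableOn_sqrt_sq_add_sq h1 hf

lemma Curve1.integrableOn_speed1 (γ : Curve1) : IntegrableOn (speed1 γ) (Icc (0 : ℝ) 1) :=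
  integrableOn_sqrt_sq_add_sq γ.dx_int γ.dy_int

lemma Curve1.len1E_eq (γ : Curve1) :
    len1E γ = ENNReal.ofReal (∫ t in (0 : ℝ)..1, speed1 γ t) := by
  rw [intervalIntegral.integral_of_le zero_le_one, integral_Ioc_eq_integral_Ioo,
    ofReal_integral_eq_lintegral_ofReal (γ.integrableOn_speed1.mono_set Ioo_subset_Icc_self)
      (Eventually.of_forall fun _ => Real.sqrt_nonneg _)]
  rfl

lemma Curve1.inner_sub_le_integral_speed1 (γ : Curve1) {A B p q : ℝ} (hAB : A ^ 2 + B ^ 2 ≤ 1)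
    (hp : p ∈ Icc (0 : ℝ) 1) (hq : q ∈ Icc (0 : ℝ) 1) (hpq : p ≤ q) :
    A * (γ.x q - γ.x p) + B * (γ.y q - γ.y p) ≤ ∫ t in p..q, speed1 γ t := by
  have hx := γ.dx_int.intervalIntegrable_of_mem hp hq
  have hy := γ.dy_int.intervalIntegrable_of_mem hp hq
  rw [sub_eq_integral_of_primitive γ.dx_int γ.ftc_x hp hq,
    sub_eq_integral_of_primitive γ.dy_int γ.ftc_y hp hq,
    ← intervalIntegral.integral_const_mul, ← intervalIntegral.integral_const_mul,
    ← intervalIntegral.integral_add (hx.const_mul A) (hy.const_mul B)]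
  refine intervalIntegral.integral_mono_on hpq ((hx.const_mul A).add (hy.const_mul B))
    (γ.integrableOn_speed1.intervalIntegrable_of_mem hp hq) fun t _ => ?_
  refine Real.le_sqrt_of_sq_le ?_
  nlinarith [sq_nonneg (A * γ.dy t - B * γ.dx t), sq_nonneg (γ.dx t), sq_nonneg (γ.dy t),
    mul_nonneg (sub_nonneg.2 hAB) (add_nonneg (sq_nonneg (γ.dx t)) (sq_nonneg (γ.dy t)))]

lemma CapAbove.strictMonoOn_x {γ : Curve1} {γ₀ : Curve} {β₁ β₂ : ℝ} {u : ℝ → ℝ}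
    (h : CapAbove γ γ₀ β₁ β₂ u) : StrictMonoOn γ.x (Ioo β₁ β₂) := by
  obtain ⟨w, dw, -, -, hxw, -⟩ := h.inv
  obtain ⟨h1, -, h2⟩ := h.hβ
  intro s hs t ht hst
  by_contra! hle
  have hc : ContinuousOn γ.x (Icc β₁ s) :=
    γ.continuousOn_x.mono (Icc_subset_Icc h1 (hs.2.le.trans h2))
  have hx0 : γ.x β₁ = 0 := h.left _ ⟨h1, le_rfl⟩
  have ht0 := (hxw t ht).1.1
  obtain ⟨r, hr, hrt⟩ := intermediate_value_Icc hs.1.le hc ⟨hx0 ▸ ht0.le, hle⟩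
  have hr1 : β₁ < r := by
    refine hr.1.lt_of_ne ?_
    rintro rfl
    linarith
  have hr' : r = t := by
    rw [← (hxw r ⟨hr1, hr.2.trans_lt hs.2⟩).2, hrt, (hxw t ht).2]
  linarith [hr.2]

lemma CapAbove.u_zero {γ : Curve1} {γ₀ : Curve} {β₁ β₂ : ℝ} {u : ℝ → ℝ}
    (h : CapAbove γ γ₀ β₁ β₂ u) : γ.y β₁ = u 0 := by
  obtain ⟨w, dw, -, -, hxw, -⟩ := h.inv
  obtain ⟨h1, h12, h2⟩ := h.hβ
  have hsub : Ioo β₁ β₂ ⊆ Icc (0 : ℝ) 1 := fun t ht => ⟨h1.trans ht.1.le, ht.2.le.trans h2⟩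
  have hmem : β₁ ∈ Icc (0 : ℝ) 1 := ⟨h1, h12.le.trans h2⟩
  have hx : Tendsto γ.x (𝓝[Ioo β₁ β₂] β₁) (𝓝[Icc 0 1] 0) := by
    refine tendsto_nhdsWithin_iff.2 ⟨?_, ?_⟩
    · rw [← h.left β₁ ⟨h1, le_rfl⟩]
      exact (γ.continuousOn_x β₁ hmem).mono hsub
    · filter_upwards [self_mem_nhdsWithin] with t ht using Ioo_subset_Icc_self (hxw t ht).1
  have hu := (h.ucont 0 (by simp)).tendsto.comp hx
  have hy : Tendsto γ.y (𝓝[Ioo β₁ β₂] β₁) (𝓝 (γ.y β₁)) := (γ.continuousOn_y β₁ hmem).mono hsub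
  have : (𝓝[Ioo β₁ β₂] β₁).NeBot := by
    rw [nhdsWithin_Ioo_eq_nhdsGT h12]; infer_instance
  refine tendsto_nhds_unique (hy.congr' ?_) hu
  filter_upwards [self_mem_nhdsWithin] with t ht using (h.graph t ht).symm

lemma CapAbove.u_one {γ : Curve1} {γ₀ : Curve} {β₁ β₂ : ℝ} {u : ℝ → ℝ}
    (h : CapAbove γ γ₀ β₁ β₂ u) : γ.y β₂ = u 1 := by
  obtain ⟨w, dw, -, -, hxw, -⟩ := h.inv
  obtain ⟨h1, h12, h2⟩ := h.hβ
  have hsub : Ioo β₁ β₂ ⊆ Icc (0 : ℝ) 1 := fun t ht => ⟨h1.trans ht.1.le, ht.2.le.trans h2⟩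
  have hmem : β₂ ∈ Icc (0 : ℝ) 1 := ⟨h1.trans h12.le, h2⟩
  have hx : Tendsto γ.x (𝓝[Ioo β₁ β₂] β₂) (𝓝[Icc 0 1] 1) := by
    refine tendsto_nhdsWithin_iff.2 ⟨?_, ?_⟩
    · rw [← h.right β₂ ⟨le_rfl, h2⟩]
      exact (γ.continuousOn_x β₂ hmem).mono hsub
    · filter_upwards [self_mem_nhdsWithin] with t ht using Ioo_subset_Icc_self (hxw t ht).1
  have hu := (h.ucont 1 (by simp)).tendsto.comp hx
  have hy : Tendsto γ.y (𝓝[Ioo β₁ β₂] β₂) (𝓝 (γ.y β₂)) := (γ.continuousOn_y β₂ hmem).mono hsub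
  have : (𝓝[Ioo β₁ β₂] β₂).NeBot := by
    rw [nhdsWithin_Ioo_eq_nhdsLT h12]; infer_instance
  refine tendsto_nhds_unique (hy.congr' ?_) hu
  filter_upwards [self_mem_nhdsWithin] with t ht using (h.graph t ht).symm

lemma sqrt_one_add_sq_le_of_forall {c d : ℝ}
    (h : ∀ A B : ℝ, A ^ 2 + B ^ 2 ≤ 1 → A + B * d ≤ c) : √(1 + d ^ 2) ≤ c := by
  have hpos : 0 < √(1 + d ^ 2) := by positivity
  have hsq : √(1 + d ^ 2) ^ 2 = 1 + d ^ 2 := Real.sq_sqrt (by positivity)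
  have := h (1 / √(1 + d ^ 2)) (d / √(1 + d ^ 2)) (by
    rw [div_pow, div_pow, hsq]; field_simp; exact le_rfl)
  refine le_trans (le_of_eq ?_) this
  field_simp
  linarith

/-- The part of the curve over the open unit interval is at least as long as the graph. -/
lemma CapAbove.graph_length_le {γ : Curve1} {γ₀ : Curve} {β₁ β₂ : ℝ} {u du : ℝ → ℝ}
    (h : CapAbove γ γ₀ β₁ β₂ u) (hdu : IntegrableOn du (Icc (0 : ℝ) 1))
    (hu : ∀ x ∈ Icc (0 : ℝ) 1, u x = u 0 + ∫ s in (0 : ℝ)..x, du s) :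
    ∫ x in (0 : ℝ)..1, √(1 + (du x) ^ 2) ≤ ∫ t in β₁..β₂, speed1 γ t := by
  have hmono := h.strictMonoOn_x
  obtain ⟨w, dw, -, -, -, hwx⟩ := h.inv
  obtain ⟨h1, h12, h2⟩ := h.hβ
  have hsub : Icc β₁ β₂ ⊆ Icc (0 : ℝ) 1 := Icc_subset_Icc h1 h2
  have hβ : β₁ ∈ Icc β₁ β₂ := ⟨le_rfl, h12.le⟩
  set W : ℝ → ℝ := fun s => if s ≤ 0 then β₁ else if 1 ≤ s then β₂ else w s with hW
  have hWin : ∀ s ∈ Ioo (0 : ℝ) 1, W s = w s := fun s hs => by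
    simp [hW, not_le.2 hs.1, not_le.2 hs.2]
  have hWmem : ∀ s, W s ∈ Icc β₁ β₂ := fun s => by
    by_cases hs0 : s ≤ 0
    · simpa [hW, hs0] using h12.le
    by_cases hs1 : 1 ≤ s
    · simpa [hW, hs0, hs1] using h12.le
    rw [hWin s ⟨not_le.1 hs0, not_le.1 hs1⟩]
    exact Ioo_subset_Icc_self (hwx s ⟨not_le.1 hs0, not_le.1 hs1⟩).1
  have hWmono : Monotone W := fun s t hst => by
    by_cases hs0 : s ≤ 0
    · have : W s = β₁ := by simp [hW, hs0]
      rw [this]; exact (hWmem t).1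
    by_cases ht1 : 1 ≤ t
    · have : W t = β₂ := by simp [hW, ht1, not_le.2 (zero_lt_one.trans_le ht1)]
      rw [this]; exact (hWmem s).2
    push Not at hs0 ht1
    have hs : s ∈ Ioo (0 : ℝ) 1 := ⟨hs0, hst.trans_lt ht1⟩
    have ht : t ∈ Ioo (0 : ℝ) 1 := ⟨hs0.trans_le hst, ht1⟩
    rw [hWin s hs, hWin t ht]
    by_contra! hlt
    have := hmono (hwx t ht).1 (hwx s hs).1 hlt
    rw [(hwx t ht).2, (hwx s hs).2] at this
    linarith
  have hint : ∀ p ∈ Icc β₁ β₂, ∀ q ∈ Icc β₁ β₂, IntervalIntegrable (speed1 γ) volume p q :=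
    fun p hp q hq => γ.integrableOn_speed1.intervalIntegrable_of_mem (hsub hp) (hsub hq)
  set F : ℝ → ℝ := fun s => ∫ t in β₁..W s, speed1 γ t with hF
  have hFsub : ∀ s t, F t - F s = ∫ r in W s..W t, speed1 γ r := fun s t =>
    intervalIntegral.integral_interval_sub_left (hint _ hβ _ (hWmem t)) (hint _ hβ _ (hWmem s))
  have hFmono : Monotone F := fun s t hst => by
    rw [← sub_nonneg, hFsub]
    exact intervalIntegral.integral_nonneg (hWmono hst) fun _ _ => Real.sqrt_nonneg _
  have hFm : MonotoneOn F (uIcc 0 1) := hFmono.monotoneOn _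
  have hF01 : F 1 - F 0 = ∫ t in β₁..β₂, speed1 γ t := by
    rw [hFsub]; simp [hW, not_le.2 (zero_lt_one (α := ℝ))]
  have hle : ∫ x in (0 : ℝ)..1, deriv F x ≤ ∫ t in β₁..β₂, speed1 γ t := by
    have := hFm.intervalIntegral_deriv_mem_uIcc
    rw [uIcc_of_le (sub_nonneg.2 (hFmono zero_le_one)), hF01] at this
    exact this.2
  refine le_trans ?_ hle
  have h0 : (0 : ℝ) ∈ Icc (0 : ℝ) 1 := by simp
  have h1' : (1 : ℝ) ∈ Icc (0 : ℝ) 1 := by simp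
  refine intervalIntegral.integral_mono_ae_restrict zero_le_one
    ((integrableOn_sqrt_one_add_sq hdu).intervalIntegrable_of_mem h0 h1')
    hFm.intervalIntegrable_deriv ?_
  have hII := hdu.intervalIntegrable_of_mem h0 h1'
  rw [← restrict_Ioo_eq_restrict_Icc]
  filter_upwards [ae_restrict_mem measurableSet_Ioo,
    ae_restrict_of_ae hFmono.ae_differentiableAt, ae_restrict_of_ae hII.ae_hasDerivAt_integral]
    with s hs hFd hud
  rw [uIcc_of_le zero_le_one] at hud
  have hud' : HasDerivAt u (du s) s := by
    refine ((hud (Ioo_subset_Icc_self hs) 0 h0).const_add (u 0)).congr_of_eventuallyEq ?_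
    filter_upwards [Icc_mem_nhds hs.1 hs.2] with x hx using hu x hx
  refine sqrt_one_add_sq_le_of_forall fun A B hAB => ?_
  have hl : HasDerivAt (fun r => A * r + B * u r) (A + B * du s) s := by
    have hA : HasDerivAt (fun r => A * r) A s := by simpa using (hasDerivAt_id s).const_mul A
    exact hA.add (hud'.const_mul B)
  have hl' := (hasDerivAt_iff_tendsto_slope.1 hl).mono_left
    (nhdsWithin_mono s (fun x (hx : x ∈ Ioi s) => ne_of_gt hx))
  have hr' := (hasDerivAt_iff_tendsto_slope.1 hFd.hasDerivAt).mono_left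
    (nhdsWithin_mono s (fun x (hx : x ∈ Ioi s) => ne_of_gt hx))
  refine le_of_tendsto_of_tendsto hl' hr' ?_
  filter_upwards [Ioo_mem_nhdsGT hs.2] with r hr
  have hr01 : r ∈ Ioo (0 : ℝ) 1 := ⟨hs.1.trans hr.1, hr.2⟩
  rw [slope_def_field, slope_def_field]
  refine div_le_div_of_nonneg_right ?_ (sub_pos.2 hr.1).le
  rw [hFsub]
  have key := γ.inner_sub_le_integral_speed1 hAB (hsub (hWmem s)) (hsub (hWmem r))
    (hWmono hr.1.le)
  have e : ∀ t ∈ Ioo (0 : ℝ) 1, γ.x (W t) = t ∧ γ.y (W t) = u t := fun t ht => by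
    obtain ⟨hm, hx⟩ := hwx t ht
    rw [hWin t ht, ← h.graph _ hm, hx]
    exact ⟨rfl, rfl⟩
  rw [(e s hs).1, (e s hs).2, (e r hr01).1, (e r hr01).2] at key
  linarith

lemma CapAbove.le_len1E {γ : Curve1} {γ₀ : Curve} {β₁ β₂ : ℝ} {u du : ℝ → ℝ}
    (h : CapAbove γ γ₀ β₁ β₂ u) (hdu : IntegrableOn du (Icc (0 : ℝ) 1))
    (hu : ∀ x ∈ Icc (0 : ℝ) 1, u x = u 0 + ∫ s in (0 : ℝ)..x, du s) :
    ENNReal.ofReal (|u 0| + (∫ x in (0 : ℝ)..1, √(1 + (du x) ^ 2)) + |u 1|) ≤ len1E γ := by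
  rw [γ.len1E_eq]
  refine ENNReal.ofReal_le_ofReal ?_
  have hgraph := h.graph_length_le hdu hu
  obtain ⟨h1, h12, h2⟩ := h.hβ
  have m0 : (0 : ℝ) ∈ Icc (0 : ℝ) 1 := by simp
  have m1 : (1 : ℝ) ∈ Icc (0 : ℝ) 1 := by simp
  have mβ₁ : β₁ ∈ Icc (0 : ℝ) 1 := ⟨h1, h12.le.trans h2⟩
  have mβ₂ : β₂ ∈ Icc (0 : ℝ) 1 := ⟨h1.trans h12.le, h2⟩
  have hint {p q : ℝ} (hp : p ∈ Icc (0 : ℝ) 1) (hq : q ∈ Icc (0 : ℝ) 1) :=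
    γ.integrableOn_speed1.intervalIntegrable_of_mem hp hq
  have hl : |u 0| ≤ ∫ t in (0 : ℝ)..β₁, speed1 γ t := by
    have hp := γ.inner_sub_le_integral_speed1 (A := 0) (B := 1) (by norm_num) m0 mβ₁ h1
    have hm := γ.inner_sub_le_integral_speed1 (A := 0) (B := -1) (by norm_num) m0 mβ₁ h1
    rw [h.u_zero, h.ep0.2] at hp hm
    exact abs_le.2 ⟨by linarith, by linarith⟩
  have hr : |u 1| ≤ ∫ t in β₂..1, speed1 γ t := by
    have hp := γ.inner_sub_le_integral_speed1 (A := 0) (B := 1) (by norm_num) mβ₂ m1 h2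
    have hm := γ.inner_sub_le_integral_speed1 (A := 0) (B := -1) (by norm_num) mβ₂ m1 h2
    rw [h.u_one, h.ep1.2] at hp hm
    exact abs_le.2 ⟨by linarith, by linarith⟩
  have e1 := intervalIntegral.integral_add_adjacent_intervals (hint m0 mβ₁) (hint mβ₁ mβ₂)
  have e2 := intervalIntegral.integral_add_adjacent_intervals (hint m0 mβ₂) (hint mβ₂ m1)
  linarith

/-- Rescaling of `k` from `[0,1]` to `[1/3,2/3]`, extended by constants of integrals `a` and `b`
over `[0,1/3]` and `[2/3,1]`. -/
def middleThird (a : ℝ) (k : ℝ → ℝ) (b t : ℝ) : ℝ :=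
  if t ≤ 1 / 3 then 3 * a else if t < 2 / 3 then 3 * k (3 * t - 1) else 3 * b

section middleThird

variable {a b t : ℝ} {k : ℝ → ℝ}

lemma middleThird_left (ht : t ≤ 1 / 3) :
    IntervalIntegrable (middleThird a k b) volume 0 t ∧
      (0 ≤ t → ∫ s in (0 : ℝ)..t, middleThird a k b s = 3 * a * t) := by
  have h : EqOn (fun _ => 3 * a) (middleThird a k b) (uIoo 0 t) := fun s hs => by
    have : s ≤ 1 / 3 := by
      rcases le_total 0 t with h0 | h0
      · rw [uIoo_of_le h0] at hs; linarith [hs.2]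
      · rw [uIoo_of_ge h0] at hs; linarith [hs.2]
    simp only [middleThird, if_pos this]
  refine ⟨intervalIntegrable_const.congr_uIoo h, fun _ => ?_⟩
  rw [← intervalIntegral.integral_congr_uIoo h]
  simp only [intervalIntegral.integral_const, smul_eq_mul]
  ring

lemma middleThird_middle (hk : IntegrableOn k (Icc (0 : ℝ) 1)) (ht : t ∈ Icc (1 / 3 : ℝ) (2 / 3)) :
    IntervalIntegrable (middleThird a k b) volume (1 / 3) t ∧
      ∫ s in (1 / 3 : ℝ)..t, middleThird a k b s = ∫ s in (0 : ℝ)..(3 * t - 1), k s := by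
  have h : EqOn (fun s => 3 * k (3 * s - 1)) (middleThird a k b) (uIoo (1 / 3) t) := fun s hs => by
    rw [uIoo_of_le ht.1] at hs
    simp only [middleThird, if_neg (not_le.2 hs.1), if_pos (hs.2.trans_le ht.2)]
  have hk' : IntervalIntegrable k volume 0 (3 * t - 1) :=
    hk.intervalIntegrable_of_mem (by simp) ⟨by linarith [ht.1], by linarith [ht.2]⟩
  have hint : IntervalIntegrable (fun s => 3 * k (3 * s - 1)) volume (1 / 3) t := by
    have := ((hk'.comp_sub_right 1).comp_mul_left (c := 3)).const_mul 3
    convert this using 1 <;> ring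
  refine ⟨hint.congr_uIoo h, ?_⟩
  rw [← intervalIntegral.integral_congr_uIoo h, intervalIntegral.integral_const_mul]
  have := intervalIntegral.smul_integral_comp_mul_sub (a := 1 / 3) (b := t) k 3 1
  rw [smul_eq_mul] at this
  rw [this]
  norm_num

lemma middleThird_right (ht : 2 / 3 ≤ t) :
    IntervalIntegrable (middleThird a k b) volume (2 / 3) t ∧
      ∫ s in (2 / 3 : ℝ)..t, middleThird a k b s = b * (3 * t - 2) := by
  have h : EqOn (fun _ => 3 * b) (middleThird a k b) (uIoo (2 / 3) t) := fun s hs => by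
    rw [uIoo_of_le ht] at hs
    have h1 : ¬ s ≤ 1 / 3 := by linarith [hs.1]
    simp only [middleThird, if_neg h1, if_neg (not_lt.2 hs.1.le)]
  refine ⟨intervalIntegrable_const.congr_uIoo h, ?_⟩
  rw [← intervalIntegral.integral_congr_uIoo h]
  simp only [intervalIntegral.integral_const, smul_eq_mul]
  ring

lemma integral_middleThird_middle (hk : IntegrableOn k (Icc (0 : ℝ) 1))
    (ht : t ∈ Icc (1 / 3 : ℝ) (2 / 3)) :
    ∫ s in (0 : ℝ)..t, middleThird a k b s = a + ∫ s in (0 : ℝ)..(3 * t - 1), k s := by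
  obtain ⟨i1, e1⟩ := middleThird_left (a := a) (b := b) (k := k) (le_refl (1 / 3 : ℝ))
  obtain ⟨i2, e2⟩ := middleThird_middle (a := a) (b := b) hk ht
  rw [← intervalIntegral.integral_add_adjacent_intervals i1 i2, e1 (by norm_num), e2]
  ring

lemma integral_middleThird_right (hk : IntegrableOn k (Icc (0 : ℝ) 1)) (ht : 2 / 3 ≤ t) :
    IntervalIntegrable (middleThird a k b) volume 0 t ∧
    ∫ s in (0 : ℝ)..t, middleThird a k b s = a + (∫ s in (0 : ℝ)..1, k s) + b * (3 * t - 2) := by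
  have hm : (2 / 3 : ℝ) ∈ Icc (1 / 3 : ℝ) (2 / 3) := by norm_num
  obtain ⟨i1, -⟩ := middleThird_left (a := a) (b := b) (k := k) (le_refl (1 / 3 : ℝ))
  obtain ⟨i2, -⟩ := middleThird_middle (a := a) (b := b) hk hm
  obtain ⟨i3, e3⟩ := middleThird_right (a := a) (b := b) (k := k) ht
  refine ⟨(i1.trans i2).trans i3, ?_⟩
  rw [← intervalIntegral.integral_add_adjacent_intervals (i1.trans i2) i3, e3,
    integral_middleThird_middle hk hm]
  norm_num

lemma integrableOn_middleThird (hk : IntegrableOn k (Icc (0 : ℝ) 1)) :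
    IntegrableOn (middleThird a k b) (Icc (0 : ℝ) 1) :=
  (intervalIntegrable_iff_integrableOn_Icc_of_le zero_le_one).1
    (integral_middleThird_right hk (by norm_num)).1

end middleThird

/-- The curve running vertically from the origin to the graph of `v`, along this graph, and
vertically to `(1,0)`, where `v` has derivative `dv`. -/
def graphCurve (v dv : ℝ → ℝ) (hdv : IntegrableOn dv (Icc (0 : ℝ) 1)) : Curve1 where
  x t := ∫ s in (0 : ℝ)..t, middleThird 0 (fun _ => 1) 0 s
  y t := ∫ s in (0 : ℝ)..t, middleThird (v 0) dv (-v 1) s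
  dx := middleThird 0 (fun _ => 1) 0
  dy := middleThird (v 0) dv (-v 1)
  dx_int := integrableOn_middleThird continuous_const.integrableOn_Icc
  dy_int := integrableOn_middleThird hdv
  ftc_x t _ := by simp
  ftc_y t _ := by simp

lemma len1E_graphCurve (v dv : ℝ → ℝ) (hdv : IntegrableOn dv (Icc (0 : ℝ) 1)) :
    len1E (graphCurve v dv hdv) =
      ENNReal.ofReal (|v 0| + (∫ x in (0 : ℝ)..1, √(1 + (dv x) ^ 2)) + |v 1|) := by
  have hs : speed1 (graphCurve v dv hdv) =
      middleThird |v 0| (fun x => √(1 + (dv x) ^ 2)) |v 1| := by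
    funext t
    simp only [speed1, graphCurve, middleThird]
    split_ifs
    · simp [Real.sqrt_sq_eq_abs, abs_mul]
    · rw [show (3 * 1 : ℝ) ^ 2 + (3 * dv (3 * t - 1)) ^ 2 = 3 ^ 2 * (1 + dv (3 * t - 1) ^ 2) by ring,
        Real.sqrt_mul (by norm_num), Real.sqrt_sq (by norm_num)]
    · simp [Real.sqrt_sq_eq_abs, abs_mul]
  rw [Curve1.len1E_eq, hs,
    (integral_middleThird_right (integrableOn_sqrt_one_add_sq hdv) (by norm_num)).2]
  norm_num

lemma capAbove_graphCurve {γ₀ : Curve} {v dv : ℝ → ℝ} (hdv : IntegrableOn dv (Icc (0 : ℝ) 1))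
    (hv : ∀ x ∈ Icc (0 : ℝ) 1, v x = v 0 + ∫ s in (0 : ℝ)..x, dv s)
    (habove : ∀ t ∈ Icc (0 : ℝ) 1, γ₀.y t ≤ v (γ₀.x t)) :
    CapAbove (graphCurve v dv hdv) γ₀ (1 / 3) (2 / 3) v := by
  have h1 : IntegrableOn (fun _ : ℝ => (1 : ℝ)) (Icc 0 1) := continuous_const.integrableOn_Icc
  have hx : ∀ t ∈ Icc (1 / 3 : ℝ) (2 / 3), (graphCurve v dv hdv).x t = 3 * t - 1 := fun t ht => by
    simp [graphCurve, integral_middleThird_middle h1 ht]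
  have hright : ∀ t : ℝ, 2 / 3 ≤ t → (graphCurve v dv hdv).x t = 1 := fun t ht => by
    simp [graphCurve, (integral_middleThird_right h1 ht).2]
  refine ⟨⟨?_, ?_⟩, ⟨?_, ?_⟩, by norm_num, fun t ht => ?_, fun t ht => hright t ht.1, ?_,
    fun t ht => ?_, continuousOn_of_primitive hdv hv, habove⟩
  · simp [graphCurve]
  · simp [graphCurve]
  · exact hright 1 (by norm_num)
  · simp only [graphCurve, (integral_middleThird_right hdv (show (2 / 3 : ℝ) ≤ 1 by norm_num)).2]
    rw [hv 1 (by simp)]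
    ring
  · simp [graphCurve, middleThird_left ht.2 |>.2 ht.1]
  · refine ⟨fun s => (s + 1) / 3, fun _ => 1 / 3, continuous_const.integrableOn_Icc,
      fun s _ => ?_, fun t ht => ?_, fun s hs => ?_⟩
    · simp only [intervalIntegral.integral_const, smul_eq_mul]
      ring
    · rw [hx t (Ioo_subset_Icc_self ht)]
      exact ⟨⟨by linarith [ht.1], by linarith [ht.2]⟩, by ring⟩
    · have hm : (s + 1) / 3 ∈ Ioo (1 / 3 : ℝ) (2 / 3) := ⟨by linarith [hs.1], by linarith [hs.2]⟩
      refine ⟨hm, ?_⟩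
      rw [hx _ (Ioo_subset_Icc_self hm)]
      ring
  · rw [hx t (Ioo_subset_Icc_self ht), hv _ ⟨by linarith [ht.1], by linarith [ht.2]⟩]
    simp only [graphCurve, integral_middleThird_middle hdv (Ioo_subset_Icc_self ht)]

/-- Among graphs above `γ₀` with the same boundary values, the graph of a length minimizer is the
shortest. -/
lemma CapAbove.integral_le_of_minimal {γ : Curve1} {γ₀ : Curve} {β₁ β₂ : ℝ} {u du v dv : ℝ → ℝ}
    (h : CapAbove γ γ₀ β₁ β₂ u) (hdu : IntegrableOn du (Icc (0 : ℝ) 1))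
    (hu : ∀ x ∈ Icc (0 : ℝ) 1, u x = u 0 + ∫ s in (0 : ℝ)..x, du s)
    (hmin : ∀ (τ : Curve1) (β₁' β₂' : ℝ) (u' : ℝ → ℝ),
      CapAbove τ γ₀ β₁' β₂' u' → len1E γ ≤ len1E τ)
    (hdv : IntegrableOn dv (Icc (0 : ℝ) 1))
    (hv : ∀ x ∈ Icc (0 : ℝ) 1, v x = v 0 + ∫ s in (0 : ℝ)..x, dv s)
    (h0 : v 0 = u 0) (h1 : v 1 = u 1)
    (habove : ∀ t ∈ Icc (0 : ℝ) 1, γ₀.y t ≤ v (γ₀.x t)) :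
    ∫ x in (0 : ℝ)..1, √(1 + (du x) ^ 2) ≤ ∫ x in (0 : ℝ)..1, √(1 + (dv x) ^ 2) := by
  have key := (h.le_len1E hdu hu).trans (hmin _ _ _ _ (capAbove_graphCurve hdv hv habove))
  have hnn : 0 ≤ ∫ x in (0 : ℝ)..1, √(1 + (dv x) ^ 2) :=
    intervalIntegral.integral_nonneg zero_le_one fun _ _ => Real.sqrt_nonneg _
  rw [len1E_graphCurve, ENNReal.ofReal_le_ofReal_iff (by positivity), h0, h1] at key
  linarith

lemma continuous_div_sqrt_one_add_sq : Continuous fun a : ℝ => a / √(1 + a ^ 2) :=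
  continuous_id.div (by fun_prop) fun a => by positivity

lemma abs_div_sqrt_one_add_sq_le (a : ℝ) : |a / √(1 + a ^ 2)| ≤ 1 := by
  rw [abs_div, abs_of_nonneg (Real.sqrt_nonneg _), div_le_one (by positivity)]
  exact Real.abs_le_sqrt (by linarith)

lemma sqrt_one_add_sq_sub_tangent (a b : ℝ) :
    √(1 + b ^ 2) - √(1 + a ^ 2) - a / √(1 + a ^ 2) * (b - a) =
      (√(1 + a ^ 2) * √(1 + b ^ 2) - (1 + a * b)) / √(1 + a ^ 2) := by
  have hpos : 0 < √(1 + a ^ 2) := by positivity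
  have hsq : √(1 + a ^ 2) ^ 2 = 1 + a ^ 2 := Real.sq_sqrt (by positivity)
  field_simp
  linarith

lemma one_add_mul_le_sqrt_mul_sqrt (a b : ℝ) : 1 + a * b ≤ √(1 + a ^ 2) * √(1 + b ^ 2) := by
  rw [← Real.sqrt_mul (by positivity)]
  exact Real.le_sqrt_of_sq_le (by nlinarith [sq_nonneg (a - b)])

lemma tangent_le_sqrt_one_add_sq (a b : ℝ) :
    0 ≤ √(1 + b ^ 2) - √(1 + a ^ 2) - a / √(1 + a ^ 2) * (b - a) := by
  rw [sqrt_one_add_sq_sub_tangent]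
  exact div_nonneg (sub_nonneg.2 (one_add_mul_le_sqrt_mul_sqrt a b)) (Real.sqrt_nonneg _)

lemma eq_of_sqrt_one_add_sq_sub_tangent_eq_zero {a b : ℝ}
    (h : √(1 + b ^ 2) - √(1 + a ^ 2) - a / √(1 + a ^ 2) * (b - a) = 0) : b = a := by
  rw [sqrt_one_add_sq_sub_tangent, div_eq_zero_iff] at h
  have hpos : √(1 + a ^ 2) ≠ 0 := by positivity
  have h' := (sub_eq_zero.1 (h.resolve_right hpos))
  have hsq : (1 + a ^ 2) * (1 + b ^ 2) = (1 + a * b) ^ 2 := by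
    rw [← h', mul_pow, Real.sq_sqrt (by positivity), Real.sq_sqrt (by positivity)]
  have : (b - a) ^ 2 = 0 := by linarith
  exact sub_eq_zero.1 (pow_eq_zero_iff two_ne_zero |>.1 this)

lemma intervalIntegrable_div_sqrt_mul {f g : ℝ → ℝ} {a b : ℝ}
    (hf : IntervalIntegrable f volume a b) (hg : IntervalIntegrable g volume a b) :
    IntervalIntegrable (fun x => f x / √(1 + (f x) ^ 2) * g x) volume a b := by
  refine hg.mono_fun ?_ (Eventually.of_forall fun x => ?_)
  · exact (continuous_div_sqrt_one_add_sq.comp_aestronglyMeasurable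
      hf.aestronglyMeasurable_restrict_uIoc).mul hg.aestronglyMeasurable_restrict_uIoc
  · beta_reduce
    rw [norm_mul]
    exact mul_le_of_le_one_left (norm_nonneg _) (abs_div_sqrt_one_add_sq_le _)

/-- If adding positive multiples of a function with derivative `g` does not decrease the length,
then the first variation of the length in this direction is nonnegative. -/
lemma first_variation_nonneg {f g : ℝ → ℝ} (hf : IntegrableOn f (Icc (0 : ℝ) 1))
    (hg : IntegrableOn g (Icc (0 : ℝ) 1))
    (h : ∀ s : ℝ, 0 < s → ∫ x in (0 : ℝ)..1, √(1 + (f x) ^ 2) ≤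
      ∫ x in (0 : ℝ)..1, √(1 + (f x + s * g x) ^ 2)) :
    0 ≤ ∫ x in (0 : ℝ)..1, f x / √(1 + (f x) ^ 2) * g x := by
  have m0 : (0 : ℝ) ∈ Icc (0 : ℝ) 1 := by simp
  have m1 : (1 : ℝ) ∈ Icc (0 : ℝ) 1 := by simp
  have hfi := hf.intervalIntegrable_of_mem m0 m1
  have hgi := hg.intervalIntegrable_of_mem m0 m1
  have hfs : ∀ s : ℝ, IntegrableOn (fun x => f x + s * g x) (Icc (0 : ℝ) 1) := fun s =>
    hf.add (hg.const_mul s)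
  have hpos : ∀ s : ℝ, 0 < s → 0 ≤ ∫ x in (0 : ℝ)..1,
      (f x + s * g x) / √(1 + (f x + s * g x) ^ 2) * g x := fun s hs => by
    have hI := intervalIntegrable_div_sqrt_mul ((hfs s).intervalIntegrable_of_mem m0 m1) hgi
    have hJ := (integrableOn_sqrt_one_add_sq hf).intervalIntegrable_of_mem m0 m1
    have hJs := (integrableOn_sqrt_one_add_sq (hfs s)).intervalIntegrable_of_mem m0 m1
    have hle : ∫ x in (0 : ℝ)..1, (√(1 + (f x + s * g x) ^ 2) - √(1 + (f x) ^ 2)) ≤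
        ∫ x in (0 : ℝ)..1, s * ((f x + s * g x) / √(1 + (f x + s * g x) ^ 2) * g x) := by
      refine intervalIntegral.integral_mono_on zero_le_one (hJs.sub hJ) (hI.const_mul s)
        fun x _ => ?_
      have := tangent_le_sqrt_one_add_sq (f x + s * g x) (f x)
      linarith
    rw [intervalIntegral.integral_sub hJs hJ, intervalIntegral.integral_const_mul] at hle
    exact nonneg_of_mul_nonneg_right ((sub_nonneg.2 (h s hs)).trans hle) hs
  have hlim : Tendsto (fun s : ℝ => ∫ x in (0 : ℝ)..1,
      (f x + s * g x) / √(1 + (f x + s * g x) ^ 2) * g x) (𝓝[>] 0)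
      (𝓝 (∫ x in (0 : ℝ)..1, f x / √(1 + (f x) ^ 2) * g x)) := by
    refine intervalIntegral.tendsto_integral_filter_of_dominated_convergence (fun x => ‖g x‖)
      (Eventually.of_forall fun s => ?_) (Eventually.of_forall fun s => ?_) hgi.norm ?_
    · exact (intervalIntegrable_div_sqrt_mul ((hfs s).intervalIntegrable_of_mem m0 m1)
        hgi).aestronglyMeasurable_restrict_uIoc
    · refine Eventually.of_forall fun x _ => ?_
      rw [norm_mul]
      exact mul_le_of_le_one_left (norm_nonneg _) (abs_div_sqrt_one_add_sq_le _)
    · refine Eventually.of_forall fun x _ => ?_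
      have hc : Continuous fun s : ℝ => (f x + s * g x) / √(1 + (f x + s * g x) ^ 2) * g x :=
        (continuous_div_sqrt_one_add_sq.comp (by fun_prop)).mul continuous_const
      simpa using (hc.tendsto 0).mono_left nhdsWithin_le_nhds
  exact ge_of_tendsto hlim (by filter_upwards [self_mem_nhdsWithin] with s hs using hpos s hs)

/-- A function whose graph over `[a,b]` is no longer than the chord is affine there. -/
lemma eq_chord_of_integral_le {f : ℝ → ℝ} {a b m : ℝ} (hab : a ≤ b)
    (hf : IntegrableOn f (Icc a b)) (hm : ∫ x in a..b, f x = m * (b - a))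
    (hle : ∫ x in a..b, √(1 + (f x) ^ 2) ≤ √(1 + m ^ 2) * (b - a)) {x : ℝ} (hx : x ∈ Icc a b) :
    ∫ s in a..x, f s = m * (x - a) := by
  have ma : a ∈ Icc a b := ⟨le_rfl, hab⟩
  have mb : b ∈ Icc a b := ⟨hab, le_rfl⟩
  have hfi := hf.intervalIntegrable_of_mem ma mb
  have hJ := (integrableOn_sqrt_one_add_sq hf).intervalIntegrable_of_mem ma mb
  have hc : ∀ c : ℝ, IntervalIntegrable (fun _ => c) volume a b := fun c =>
    intervalIntegrable_const
  set T : ℝ → ℝ := fun x => √(1 + (f x) ^ 2) - √(1 + m ^ 2) - m / √(1 + m ^ 2) * (f x - m) with hT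
  have hTi : IntervalIntegrable T volume a b := (hJ.sub (hc _)).sub ((hfi.sub (hc _)).const_mul _)
  have hT0 : ∀ x, 0 ≤ T x := fun x => tangent_le_sqrt_one_add_sq m (f x)
  have hTle : ∫ x in a..b, T x ≤ 0 := by
    simp only [hT]
    rw [intervalIntegral.integral_sub (hJ.sub (hc _)) ((hfi.sub (hc _)).const_mul _),
      intervalIntegral.integral_sub hJ (hc _), intervalIntegral.integral_const_mul,
      intervalIntegral.integral_sub hfi (hc _), hm]
    simp only [intervalIntegral.integral_const, smul_eq_mul]
    nlinarith
  have hTz := (intervalIntegral.integral_eq_zero_iff_of_le_of_nonneg_ae hab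
    (Eventually.of_forall hT0) hTi).1
    (le_antisymm hTle (intervalIntegral.integral_nonneg hab fun x _ => hT0 x))
  have hae : ∀ᵐ s, s ∈ uIoc a x → f s = m := by
    rw [uIoc_of_le hx.1]
    filter_upwards [(ae_restrict_iff' measurableSet_Ioc).1 hTz] with s hs hsx
    exact eq_of_sqrt_one_add_sq_sub_tangent_eq_zero (hs ⟨hsx.1, hsx.2.trans hx.2⟩)
  rw [intervalIntegral.integral_congr_ae hae]
  simp [mul_comm]

lemma CapAbove.eq_chord_of_minimal {γ : Curve1} {γ₀ : Curve} {β₁ β₂ : ℝ} {u du : ℝ → ℝ}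
    (h : CapAbove γ γ₀ β₁ β₂ u) (hdu : IntegrableOn du (Icc (0 : ℝ) 1))
    (hu : ∀ x ∈ Icc (0 : ℝ) 1, u x = u 0 + ∫ s in (0 : ℝ)..x, du s)
    (hmin : ∀ (τ : Curve1) (β₁' β₂' : ℝ) (u' : ℝ → ℝ),
      CapAbove τ γ₀ β₁' β₂' u' → len1E γ ≤ len1E τ)
    {a b c : ℝ} (ha : 0 < a) (hab : a < b) (hb : b < 1) (hca : c ≤ u a) (hcb : c ≤ u b)
    (hc : ∀ t ∈ Icc (0 : ℝ) 1, γ₀.x t ∈ Icc a b → γ₀.y t ≤ c) {x : ℝ} (hx : x ∈ Icc a b) :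
    u x = u a + (u b - u a) / (b - a) * (x - a) := by
  have hba : 0 < b - a := sub_pos.2 hab
  set m := (u b - u a) / (b - a) with hm
  have hmba : m * (b - a) = u b - u a := by rw [hm]; field_simp
  have hsub : Icc a b ⊆ Icc (0 : ℝ) 1 := Icc_subset_Icc ha.le hb.le
  have m0 : (0 : ℝ) ∈ Icc (0 : ℝ) 1 := by simp
  have m1 : (1 : ℝ) ∈ Icc (0 : ℝ) 1 := by simp
  have ma : a ∈ Icc (0 : ℝ) 1 := hsub ⟨le_rfl, hab.le⟩
  have mb : b ∈ Icc (0 : ℝ) 1 := hsub ⟨hab.le, le_rfl⟩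
  have hdiff {p q : ℝ} (hp : p ∈ Icc (0 : ℝ) 1) (hq : q ∈ Icc (0 : ℝ) 1) :=
    sub_eq_integral_of_primitive hdu hu hp hq
  set v : ℝ → ℝ := fun y => if y ∈ Icc a b then u a + m * (y - a) else u y with hvdef
  set dv : ℝ → ℝ := fun y => if y ∈ Icc a b then m else du y with hdvdef
  have e1 : ∀ y ≤ a, EqOn du dv (uIoo 0 y) := fun y hy s hs => by
    have : s < a := hs.2.trans_le (sup_le ha.le hy)
    simp [hdvdef, not_le.2 this]
  have e2 : ∀ y ∈ Icc a b, EqOn (fun _ => m) dv (uIoo a y) := fun y hy s hs => by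
    rw [uIoo_of_le hy.1] at hs
    simp [hdvdef, hs.1.le, hs.2.le.trans hy.2]
  have e3 : ∀ y, b ≤ y → EqOn du dv (uIoo b y) := fun y hy s hs => by
    rw [uIoo_of_le hy] at hs
    simp [hdvdef, not_le.2 hs.1]
  have mb' : b ∈ Icc a b := ⟨hab.le, le_rfl⟩
  have i1 : ∀ y ∈ Icc (0 : ℝ) 1, y ≤ a → IntervalIntegrable dv volume 0 y := fun y hy hya =>
    (hdu.intervalIntegrable_of_mem m0 hy).congr_uIoo (e1 y hya)
  have i2 : ∀ y ∈ Icc a b, IntervalIntegrable dv volume a y := fun y hy =>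
    intervalIntegrable_const.congr_uIoo (e2 y hy)
  have i3 : ∀ y ∈ Icc (0 : ℝ) 1, b ≤ y → IntervalIntegrable dv volume b y := fun y hy hby =>
    (hdu.intervalIntegrable_of_mem mb hy).congr_uIoo (e3 y hby)
  have i01 : IntervalIntegrable dv volume 0 1 :=
    ((i1 a ma le_rfl).trans (i2 b mb')).trans (i3 1 m1 hb.le)
  have hdv : IntegrableOn dv (Icc (0 : ℝ) 1) :=
    (intervalIntegrable_iff_integrableOn_Icc_of_le zero_le_one).1 i01
  have v0 : v 0 = u 0 := by simp [hvdef, not_le.2 ha]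
  have v1 : v 1 = u 1 := by simp [hvdef, not_le.2 hb]
  have hI1 : ∀ y ∈ Icc (0 : ℝ) 1, y ≤ a → ∫ s in (0 : ℝ)..y, dv s = u y - u 0 :=
    fun y hy hya => by rw [← intervalIntegral.integral_congr_uIoo (e1 y hya), hdiff m0 hy]
  have hI2 : ∀ y ∈ Icc a b, ∫ s in (0 : ℝ)..y, dv s = u a - u 0 + m * (y - a) := fun y hy => by
    rw [← intervalIntegral.integral_add_adjacent_intervals (i1 a ma le_rfl) (i2 y hy),
      hI1 a ma le_rfl, ← intervalIntegral.integral_congr_uIoo (e2 y hy)]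
    simp [mul_comm]
  have hv : ∀ y ∈ Icc (0 : ℝ) 1, v y = v 0 + ∫ s in (0 : ℝ)..y, dv s := fun y hy => by
    rw [v0]
    by_cases hyab : y ∈ Icc a b
    · rw [hI2 y hyab]
      simp only [hvdef, if_pos hyab]
      ring
    · simp only [hvdef, if_neg hyab]
      rcases le_total y a with hya | hya
      · rw [hI1 y hy hya]
        ring
      · have hby : b ≤ y := by
          by_contra! hlt
          exact hyab ⟨hya, hlt.le⟩
        rw [← intervalIntegral.integral_add_adjacent_intervals
          ((i1 a ma le_rfl).trans (i2 b mb')) (i3 y hy hby), hI2 b mb', hmba,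
          ← intervalIntegral.integral_congr_uIoo (e3 y hby), ← hdiff mb hy]
        ring
  have habove : ∀ t ∈ Icc (0 : ℝ) 1, γ₀.y t ≤ v (γ₀.x t) := fun t ht => by
    by_cases hxt : γ₀.x t ∈ Icc a b
    · refine (hc t ht hxt).trans ?_
      simp only [hvdef, if_pos hxt]
      set y := γ₀.x t
      have key : (b - a) * (u a + m * (y - a)) = (b - y) * u a + (y - a) * u b := by
        linear_combination (y - a) * hmba
      have hy1 := sub_nonneg.2 hxt.1
      have hy2 := sub_nonneg.2 hxt.2
      refine le_of_mul_le_mul_left ?_ hba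
      rw [key]
      nlinarith [mul_le_mul_of_nonneg_left hca hy2, mul_le_mul_of_nonneg_left hcb hy1]
    · simp only [hvdef, if_neg hxt]
      exact h.above t ht
  have hlen := h.integral_le_of_minimal hdu hu hmin hdv hv v0 v1 habove
  have hJ {p q : ℝ} (hp : p ∈ Icc (0 : ℝ) 1) (hq : q ∈ Icc (0 : ℝ) 1) :=
    (integrableOn_sqrt_one_add_sq hdu).intervalIntegrable_of_mem hp hq
  have hJv {p q : ℝ} (hp : p ∈ Icc (0 : ℝ) 1) (hq : q ∈ Icc (0 : ℝ) 1) :=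
    (integrableOn_sqrt_one_add_sq hdv).intervalIntegrable_of_mem hp hq
  rw [← intervalIntegral.integral_add_adjacent_intervals (hJ m0 mb) (hJ mb m1),
    ← intervalIntegral.integral_add_adjacent_intervals (hJ m0 ma) (hJ ma mb),
    ← intervalIntegral.integral_add_adjacent_intervals (hJv m0 mb) (hJv mb m1),
    ← intervalIntegral.integral_add_adjacent_intervals (hJv m0 ma) (hJv ma mb),
    intervalIntegral.integral_congr_uIoo
      (fun s hs => by simp only [e1 a le_rfl hs] : EqOn _ (fun s => √(1 + (dv s) ^ 2)) (uIoo 0 a)),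
    intervalIntegral.integral_congr_uIoo
      (fun s hs => by simp only [e3 1 hb.le hs] : EqOn (fun s => √(1 + (du s) ^ 2))
        (fun s => √(1 + (dv s) ^ 2)) (uIoo b 1)),
    ← intervalIntegral.integral_congr_uIoo
      (fun s hs => by simp only [← e2 b mb' hs] : EqOn (fun _ => √(1 + m ^ 2))
        (fun s => √(1 + (dv s) ^ 2)) (uIoo a b)),
    intervalIntegral.integral_const, smul_eq_mul] at hlen
  have := eq_chord_of_integral_le hab.le (hdu.mono_set hsub)
    (by rw [← hdiff ma mb, hmba]) (by linarith) hx
  rw [← hdiff ma (hsub hx)] at this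
  linarith

lemma CapAbove.isOpen_noncontact {γ : Curve1} {γ₀ : Curve} {β₁ β₂ : ℝ} {u : ℝ → ℝ}
    (h : CapAbove γ γ₀ β₁ β₂ u) :
    IsOpen {x : ℝ | x ∈ Ioo (0 : ℝ) 1 ∧
      (x, u x) ∉ (fun t => (γ₀.x t, γ₀.y t)) '' Icc (0 : ℝ) 1} := by
  have hK : IsCompact ((fun t => (γ₀.x t, γ₀.y t)) '' Icc (0 : ℝ) 1) :=
    isCompact_Icc.image_of_continuousOn (γ₀.continuousOn_x.prodMk γ₀.continuousOn_y)
  have hc : ContinuousOn (fun x => (x, u x)) (Ioo (0 : ℝ) 1) :=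
    continuousOn_id.prodMk (h.ucont.mono Ioo_subset_Icc_self)
  exact hc.isOpen_inter_preimage isOpen_Ioo hK.isClosed.isOpen_compl

lemma CapAbove.locally_affine_of_minimal {γ : Curve1} {γ₀ : Curve} {β₁ β₂ : ℝ} {u du : ℝ → ℝ}
    (h : CapAbove γ γ₀ β₁ β₂ u) (hdu : IntegrableOn du (Icc (0 : ℝ) 1))
    (hu : ∀ x ∈ Icc (0 : ℝ) 1, u x = u 0 + ∫ s in (0 : ℝ)..x, du s)
    (hmin : ∀ (τ : Curve1) (β₁' β₂' : ℝ) (u' : ℝ → ℝ),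
      CapAbove τ γ₀ β₁' β₂' u' → len1E γ ≤ len1E τ)
    {x : ℝ} (hx : x ∈ Ioo (0 : ℝ) 1)
    (hxu : (x, u x) ∉ (fun t => (γ₀.x t, γ₀.y t)) '' Icc (0 : ℝ) 1) :
    ∃ ε > 0, ∃ c m : ℝ, ∀ y : ℝ, |y - x| < ε → u y = c + m * y := by
  have hK : IsCompact ((fun t => (γ₀.x t, γ₀.y t)) '' Icc (0 : ℝ) 1) :=
    isCompact_Icc.image_of_continuousOn (γ₀.continuousOn_x.prodMk γ₀.continuousOn_y)
  obtain ⟨r, hr, hrK⟩ := Metric.isOpen_iff.1 hK.isClosed.isOpen_compl _ hxu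
  have hux : ContinuousAt u x := h.ucont.continuousAt (Icc_mem_nhds hx.1 hx.2)
  have e1 : ∀ᶠ y in 𝓝 x, u y ∈ Metric.ball (u x) r := hux (Metric.ball_mem_nhds _ hr)
  have e2 : ∀ᶠ y in 𝓝 x, y ∈ Metric.ball x r := Metric.ball_mem_nhds _ hr
  have e3 : ∀ᶠ y in 𝓝 x, y ∈ Ioo (0 : ℝ) 1 := Ioo_mem_nhds hx.1 hx.2
  obtain ⟨δ, hδ, hδ'⟩ := Metric.eventually_nhds_iff.1 (e1.and (e2.and e3))
  have hnear : ∀ y ∈ Icc (x - δ / 2) (x + δ / 2), dist y x < δ := fun y hy => by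
    rw [Real.dist_eq, abs_lt]
    exact ⟨by linarith [hy.1], by linarith [hy.2]⟩
  have ma : x - δ / 2 ∈ Icc (x - δ / 2) (x + δ / 2) := ⟨le_rfl, by linarith⟩
  have mb : x + δ / 2 ∈ Icc (x - δ / 2) (x + δ / 2) := ⟨by linarith, le_rfl⟩
  have hlow : ∀ y ∈ Icc (x - δ / 2) (x + δ / 2), u x - r ≤ u y := fun y hy => by
    have := (hδ' (hnear y hy)).1
    rw [Metric.mem_ball, Real.dist_eq, abs_lt] at this
    linarith
  have hobs : ∀ t ∈ Icc (0 : ℝ) 1, γ₀.x t ∈ Icc (x - δ / 2) (x + δ / 2) → γ₀.y t ≤ u x - r :=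
    fun t ht hxt => by
      obtain ⟨h1, h2, -⟩ := hδ' (hnear _ hxt)
      rw [Metric.mem_ball, Real.dist_eq, abs_lt] at h1
      by_contra! hlt
      refine hrK (?_ : (γ₀.x t, γ₀.y t) ∈ Metric.ball (x, u x) r) ⟨t, ht, rfl⟩
      rw [← ball_prod_same]
      refine ⟨h2, ?_⟩
      rw [Metric.mem_ball, Real.dist_eq, abs_lt]
      exact ⟨by linarith, by linarith [h.above t ht]⟩
  have key := fun y hy => h.eq_chord_of_minimal hdu hu hmin (hδ' (hnear _ ma)).2.2.1 (by linarith)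
    (hδ' (hnear _ mb)).2.2.2 (hlow _ ma) (hlow _ mb) hobs (x := y) hy
  set a := x - δ / 2 with ha
  set b := x + δ / 2 with hb
  refine ⟨δ / 2, half_pos hδ, u a - (u b - u a) / (b - a) * a, (u b - u a) / (b - a),
    fun y hy => ?_⟩
  rw [abs_lt] at hy
  rw [key y ⟨by linarith, by linarith⟩]
  ring

/-- A variational inequality on the top for minimizers of the trace-length
problem, openness of the non-contact set `U`, smoothness and `u'' = 0` on `U`. -/
theorem stmt14 (ψ : ℝ → ℝ) (hψ : Admissible ψ) (γ₀ : Curve) (hγ₀ : MemP ψ γ₀)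
    (γ : Curve1) (β₁ β₂ : ℝ) (u du : ℝ → ℝ)
    (hcap : CapAbove γ γ₀ β₁ β₂ u)
    (hdu_int : IntegrableOn du (Icc (0:ℝ) 1))
    (hftc : ∀ x ∈ Icc (0:ℝ) 1, u x = u 0 + ∫ s in (0:ℝ)..x, du s)
    (hmin : ∀ (τ : Curve1) (β₁' β₂' : ℝ) (u' : ℝ → ℝ),
      CapAbove τ γ₀ β₁' β₂' u' → len1E γ ≤ len1E τ) :
    -- the variational inequality
    (∀ φ : ℝ → ℝ, ContDiff ℝ (⊤ : ℕ∞) φ → HasCompactSupport φ → tsupport φ ⊆ Ioo (0:ℝ) 1 →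
      (∀ x, 0 ≤ φ x) →
      0 ≤ ∫ x in Ioo (0:ℝ) 1, (du x / Real.sqrt (1 + (du x)^2)) * deriv φ x) ∧
    -- U is open
    IsOpen {x : ℝ | x ∈ Ioo (0:ℝ) 1 ∧
      (x, u x) ∉ (fun t => (γ₀.x t, γ₀.y t)) '' Icc (0:ℝ) 1} ∧
    -- u ∈ C^∞(U)
    ContDiffOn ℝ (⊤ : ℕ∞) u {x : ℝ | x ∈ Ioo (0:ℝ) 1 ∧
      (x, u x) ∉ (fun t => (γ₀.x t, γ₀.y t)) '' Icc (0:ℝ) 1} ∧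
    -- u'' = 0 on U (u is locally affine there)
    (∀ x ∈ {x : ℝ | x ∈ Ioo (0:ℝ) 1 ∧
        (x, u x) ∉ (fun t => (γ₀.x t, γ₀.y t)) '' Icc (0:ℝ) 1},
      ∃ ε > 0, ∃ c m : ℝ, ∀ y : ℝ, |y - x| < ε → u y = c + m * y) := by
  have haff : ∀ x ∈ {x : ℝ | x ∈ Ioo (0:ℝ) 1 ∧
      (x, u x) ∉ (fun t => (γ₀.x t, γ₀.y t)) '' Icc (0:ℝ) 1},
      ∃ ε > 0, ∃ c m : ℝ, ∀ y : ℝ, |y - x| < ε → u y = c + m * y := fun x hx =>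
    hcap.locally_affine_of_minimal hdu_int hftc hmin hx.1 hx.2
  refine ⟨fun φ hφ _ hφs hφ0 => ?_, hcap.isOpen_noncontact, fun x hx => ?_, haff⟩
  · have hφ' : Continuous (deriv φ) := hφ.continuous_deriv (by simp)
    have hz : ∀ x, x ∉ Ioo (0 : ℝ) 1 → φ x = 0 := fun x hx =>
      image_eq_zero_of_notMem_tsupport fun hxs => hx (hφs hxs)
    have hφi : ∀ x, φ x = ∫ s in (0 : ℝ)..x, deriv φ s := fun x => by
      rw [intervalIntegral.integral_deriv_eq_sub
        (fun y _ => (hφ.differentiable (by simp)).differentiableAt)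
        (hφ'.intervalIntegrable _ _), hz 0 (by simp), sub_zero]
    have hφI : IntegrableOn (deriv φ) (Icc (0 : ℝ) 1) := hφ'.integrableOn_Icc
    have key := first_variation_nonneg hdu_int hφI fun s hs => by
      refine hcap.integral_le_of_minimal (v := fun x => u x + s * φ x) hdu_int hftc hmin
        (hdu_int.add (hφI.const_mul s)) (fun x hx => ?_) (by simp [hz]) (by simp [hz])
        fun t ht => ?_
      · have i1 := hdu_int.intervalIntegrable_of_mem (by simp : (0 : ℝ) ∈ Icc (0 : ℝ) 1) hx
        rw [intervalIntegral.integral_add i1 ((hφ'.intervalIntegrable _ _).const_mul s),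
          intervalIntegral.integral_const_mul, ← hφi x, hftc x hx, hz 0 (by simp)]
        ring
      · exact (hcap.above t ht).trans
          (le_add_of_nonneg_right (mul_nonneg hs.le (hφ0 _)))
    rwa [intervalIntegral.integral_of_le zero_le_one, integral_Ioc_eq_integral_Ioo] at key
  · obtain ⟨ε, hε, c, m, hu⟩ := haff x hx
    have hlin : ContDiffAt ℝ (⊤ : ℕ∞) (fun y => c + m * y) x := by fun_prop
    refine (hlin.congr_of_eventuallyEq ?_).contDiffWithinAt
    filter_upwards [Metric.ball_mem_nhds x hε] with y hy
    exact hu y (by rwa [Metric.mem_ball, Real.dist_eq] at hy)
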